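/- Let A be a real symmetric n×n matrix with (real) eigenvalues λ_1, …, λ_n, let μ ∈ ℝ with μ ≠ 0 and μ ≠ λ_j for all j, and let α > 0. Assume the eigenvalues are not all at the same distance from μ, i.e., there exist j, k with |λ_j − μ| ≠ |λ_k − μ|. Set σ = μ(1 + αi). Then both A − σI and A − μI are invertible (as complex matrices), and κ(A − σI) < κ(A − μI), where κ(M) = ‖M‖ · ‖M⁻¹‖ is the condition number with respect to the operator norm induced by the Euclidean norm on ℂⁿ. -/

import Mathlib

open Matrix

/-- The operator norm of an `n × n` complex matrix, induced by the Euclidean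
norm on `ℂⁿ`. -/
noncomputable def euclOpNorm {n : ℕ} (M : Matrix (Fin n) (Fin n) ℂ) : ℝ :=
  ‖Matrix.toEuclideanCLM (𝕜 := ℂ) (n := Fin n) M‖

/-- The spectral condition number `κ(X) = ‖X‖ ‖X⁻¹‖` of an `n × n` complex matrix. -/
noncomputable def condNum {n : ℕ} (M : Matrix (Fin n) (Fin n) ℂ) : ℝ :=
  euclOpNorm M * euclOpNorm M⁻¹

open scoped Matrix.Norms.L2Operator in
theorem euclOpNorm_unitary_conj_diagonal {n : ℕ} (U : unitary (Matrix (Fin n) (Fin n) ℂ))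
    (d : Fin n → ℂ) :
    euclOpNorm (U.1 * diagonal d * star U.1) = ‖d‖ := by
  rw [euclOpNorm, ← Matrix.cstar_norm_def, ← Unitary.coe_star, CStarRing.norm_mul_coe_unitary,
    CStarRing.norm_coe_unitary_mul, l2_opNorm_diagonal]

theorem unitary_conj_diagonal_mul_inv {n : ℕ} (U : unitary (Matrix (Fin n) (Fin n) ℂ))
    (d : Fin n → ℂ) (hd : ∀ j, d j ≠ 0) :
    (U.1 * diagonal d * star U.1) *
      (U.1 * diagonal d⁻¹ * star U.1) = 1 := by
  have hdd : diagonal d * diagonal d⁻¹ = 1 := by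
    rw [diagonal_mul_diagonal, ← diagonal_one]
    congr 1
    funext j
    simp [hd j]
  calc _ = U.1 * (diagonal d * (star U.1 * U.1) *
        diagonal d⁻¹) * star U.1 := by simp only [Matrix.mul_assoc]
    _ = 1 := by
      rw [Unitary.coe_star_mul_self, Matrix.mul_one, hdd, Matrix.mul_one,
        Unitary.mul_star_self_of_mem U.2]

theorem condNum_unitary_conj_diagonal {n : ℕ} (U : unitary (Matrix (Fin n) (Fin n) ℂ))
    (d : Fin n → ℂ) (hd : ∀ j, d j ≠ 0) :
    condNum (U.1 * diagonal d * star U.1) =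
      ‖d‖ * ‖d⁻¹‖ := by
  rw [condNum, inv_eq_right_inv (unitary_conj_diagonal_mul_inv U d hd),
    euclOpNorm_unitary_conj_diagonal, euclOpNorm_unitary_conj_diagonal]

/-- All shifts of a real symmetric matrix are simultaneously unitarily diagonalizable over `ℂ`. -/
theorem exists_unitary_map_sub_smul_one_eq {n : ℕ} (A : Matrix (Fin n) (Fin n) ℝ)
    (hA : A.IsHermitian) :
    ∃ U : unitary (Matrix (Fin n) (Fin n) ℂ), ∀ z : ℂ,
      A.map ((↑) : ℝ → ℂ) - z • 1 = U.1 *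
        diagonal (fun j => (hA.eigenvalues j : ℂ) - z) * star U.1 := by
  set V : Matrix (Fin n) (Fin n) ℝ := (hA.eigenvectorUnitary).1 with hV
  have hstar : (star V).map ((↑) : ℝ → ℂ) = star (V.map ((↑) : ℝ → ℂ)) := by
    ext i j
    simp [star_apply]
  have hmul (B C : Matrix (Fin n) (Fin n) ℝ) :
      (B * C).map ((↑) : ℝ → ℂ) = B.map ((↑) : ℝ → ℂ) * C.map ((↑) : ℝ → ℂ) :=
    Matrix.map_mul (f := Complex.ofRealHom)
  have hone : (1 : Matrix (Fin n) (Fin n) ℝ).map ((↑) : ℝ → ℂ) = 1 := by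
    simp
  have hU : V.map ((↑) : ℝ → ℂ) ∈ unitary (Matrix (Fin n) (Fin n) ℂ) := by
    rw [Unitary.mem_iff, ← hstar, ← hmul, ← hmul, hV, Unitary.coe_star_mul_self,
      Unitary.mul_star_self_of_mem hA.eigenvectorUnitary.2, hone]
    exact ⟨rfl, rfl⟩
  have hspec : A.map ((↑) : ℝ → ℂ) = V.map ((↑) : ℝ → ℂ) *
      diagonal (fun j => (hA.eigenvalues j : ℂ)) * star (V.map ((↑) : ℝ → ℂ)) := by
    conv_lhs => rw [hA.spectral_theorem, Unitary.conjStarAlgAut_apply, hmul, hmul, hstar]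
    rw [diagonal_map Complex.ofReal_zero]
    rfl
  refine ⟨⟨_, hU⟩, fun z => ?_⟩
  have hdiag : diagonal (fun j => (hA.eigenvalues j : ℂ) - z) =
      diagonal (fun j => (hA.eigenvalues j : ℂ)) - z • 1 := by
    rw [smul_one_eq_diagonal, diagonal_sub]
  rw [hdiag, Matrix.mul_sub, Matrix.sub_mul, ← hspec, mul_smul_comm, Matrix.mul_one,
    smul_mul_assoc, Unitary.mul_star_self_of_mem hU]

/-- Adding a common nonzero imaginary part to nonzero reals that are not all of the same absolute
value decreases the ratio of the largest modulus to the smallest. -/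
theorem norm_mul_norm_inv_sub_mul_I_lt {ι : Type*} [Fintype ι] (d : ι → ℝ)
    (hd : ∀ j, d j ≠ 0) (hne : ∃ j k, |d j| ≠ |d k|) {b : ℝ} (hb : b ≠ 0) :
    ‖(fun j => (d j : ℂ) - b * Complex.I)‖ * ‖(fun j => (d j : ℂ) - b * Complex.I)⁻¹‖ <
      ‖(fun j => (d j : ℂ))‖ * ‖(fun j => (d j : ℂ))⁻¹‖ := by
  obtain ⟨j, k, hjk⟩ := hne
  have : Nonempty ι := ⟨j⟩
  obtain ⟨p, hp⟩ := Finite.exists_max fun i => |d i|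
  obtain ⟨q, hq⟩ := Finite.exists_min fun i => |d i|
  have hqp : |d q| < |d p| := by
    refine lt_of_le_of_ne (hp q) fun h => hjk ?_
    linarith [hp j, hp k, hq j, hq k]
  have hq0 : 0 < |d q| := abs_pos.mpr (hd q)
  have hp0 : 0 < |d p| := hq0.trans hqp
  have hb2 : 0 < b ^ 2 := by positivity
  have hnorm (i : ι) : ‖(d i : ℂ) - b * Complex.I‖ = √(|d i| ^ 2 + b ^ 2) := by
    rw [Complex.norm_def, Complex.normSq_apply]
    simp [pow_two]
  have hmax : ‖(fun j => (d j : ℂ) - b * Complex.I)‖ ≤ √(|d p| ^ 2 + b ^ 2) := by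
    refine (pi_norm_le_iff_of_nonneg (Real.sqrt_nonneg _)).mpr fun i => ?_
    rw [hnorm]
    exact Real.sqrt_le_sqrt (by linarith [pow_le_pow_left₀ (abs_nonneg (d i)) (hp i) 2])
  have hmin : ‖(fun j => (d j : ℂ) - b * Complex.I)⁻¹‖ ≤ (√(|d q| ^ 2 + b ^ 2))⁻¹ := by
    refine (pi_norm_le_iff_of_nonneg (by positivity)).mpr fun i => ?_
    rw [Pi.inv_apply, norm_inv, hnorm]
    refine inv_anti₀ (by positivity) (Real.sqrt_le_sqrt ?_)
    linarith [pow_le_pow_left₀ (abs_nonneg (d q)) (hq i) 2]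
  have hmax' : |d p| ≤ ‖(fun j => (d j : ℂ))‖ := by
    simpa using norm_le_pi_norm (fun j => (d j : ℂ)) p
  have hmin' : |d q|⁻¹ ≤ ‖(fun j => (d j : ℂ))⁻¹‖ := by
    simpa using norm_le_pi_norm (fun j => (d j : ℂ))⁻¹ q
  have hratio : √(|d p| ^ 2 + b ^ 2) * (√(|d q| ^ 2 + b ^ 2))⁻¹ < |d p| * |d q|⁻¹ := by
    rw [← div_eq_mul_inv, ← div_eq_mul_inv, ← Real.sqrt_div (add_nonneg (sq_nonneg _) hb2.le),
      Real.sqrt_lt' (div_pos hp0 hq0), div_pow, div_lt_div_iff₀ (by positivity) (by positivity)]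
    have hsq : |d q| ^ 2 < |d p| ^ 2 := by gcongr
    nlinarith
  calc _ ≤ √(|d p| ^ 2 + b ^ 2) * (√(|d q| ^ 2 + b ^ 2))⁻¹ := by gcongr
    _ < |d p| * |d q|⁻¹ := hratio
    _ ≤ _ := by gcongr

theorem condNum_complex_shift_lt {n : ℕ} (hn : 0 < n)
    (A : Matrix (Fin n) (Fin n) ℝ) (hA : A.IsHermitian)
    (μ : ℝ) (hμ : μ ≠ 0) (hμe : ∀ j, hA.eigenvalues j ≠ μ)
    (α : ℝ) (hα : 0 < α)
    (hdiff : ∃ j k, |hA.eigenvalues j - μ| ≠ |hA.eigenvalues k - μ|) :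
    IsUnit (A.map ((↑) : ℝ → ℂ) - ((μ : ℂ) * (1 + α * Complex.I)) • 1) ∧
    IsUnit (A.map ((↑) : ℝ → ℂ) - (μ : ℂ) • 1) ∧
    condNum (A.map ((↑) : ℝ → ℂ) - ((μ : ℂ) * (1 + α * Complex.I)) • 1)
      < condNum (A.map ((↑) : ℝ → ℂ) - (μ : ℂ) • 1) := by
  obtain ⟨U, hU⟩ := exists_unitary_map_sub_smul_one_eq A hA
  have hd (j : Fin n) : hA.eigenvalues j - μ ≠ 0 := sub_ne_zero.mpr (hμe j)
  have hreal : (fun j => (hA.eigenvalues j : ℂ) - μ) =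
      fun j => ((hA.eigenvalues j - μ : ℝ) : ℂ) := by
    funext j
    push_cast
    rfl
  have hcomplex : (fun j => (hA.eigenvalues j : ℂ) - μ * (1 + α * Complex.I)) =
      fun j => ((hA.eigenvalues j - μ : ℝ) : ℂ) - ((μ * α : ℝ) : ℂ) * Complex.I := by
    funext j
    push_cast
    ring
  have hreal0 (j : Fin n) : ((hA.eigenvalues j - μ : ℝ) : ℂ) ≠ 0 :=
    Complex.ofReal_ne_zero.mpr (hd j)
  have hcomplex0 (j : Fin n) :
      ((hA.eigenvalues j - μ : ℝ) : ℂ) - ((μ * α : ℝ) : ℂ) * Complex.I ≠ 0 := fun h =>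
    hd j (by simpa using congrArg Complex.re h)
  rw [hU, hU, hreal, hcomplex]
  refine ⟨IsUnit.of_mul_eq_one _ (unitary_conj_diagonal_mul_inv U _ hcomplex0),
    IsUnit.of_mul_eq_one _ (unitary_conj_diagonal_mul_inv U _ hreal0), ?_⟩
  rw [condNum_unitary_conj_diagonal U _ hcomplex0, condNum_unitary_conj_diagonal U _ hreal0]
  exact norm_mul_norm_inv_sub_mul_I_lt _ hd hdiff (mul_ne_zero hμ hα.ne')
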